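/- arXiv:1105.4952 — 7 statements merged into one kernel-verified Lean document; each statement's English description precedes it below -/
import Mathlib

section
/- Reduction of spin-ℓ/2 Hermitian elementary matrices to spin-1/2 elementary matrices (Proposition 2.1, square-root-free form): Let ℓ ≥ 1, η, ξ₁ ∈ ℂ, q = e^η with q^{2k} ≠ 1 for 1 ≤ k ≤ ℓ. Set w_j = ξ₁ − (j−1)η for j = 1,…,ℓ and χ = diag(1,e^{w₁}) ⊗ ⋯ ⊗ diag(1,e^{w_ℓ}) on (ℂ²)^{⊗ℓ}. Fix integers 0 ≤ i, j ≤ ℓ and any tuple (ε'₁,…,ε'_ℓ) ∈ {0,1}^ℓ with exactly i entries equal to 1. Then ||ℓ,i⟩~ ⟨ℓ,j|| = ([ℓ¦i]_q / [ℓ¦j]_q) · e^{η(j(ℓ−j)−i(ℓ−i))/2} · e^{−(i−j)(ξ₁−(ℓ−1)η/2)} · P̃^{(ℓ)} · Σ_{(ε₁,…,ε_ℓ)} χ e₁^{ε'₁,ε₁} ⋯ e_ℓ^{ε'_ℓ,ε_ℓ} χ^{−1}, where the sum runs over all tuples (ε₁,…,ε_ℓ) ∈ {0,1}^ℓ with exactly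 j entries equal to 1. In particular, the right-hand side is independent of the choice of the tuple (ε'₁,…,ε'_ℓ) among those with exactly i ones. -/
open scoped BigOperators

/-- The q-integer [k]_q = (q^k − q^{−k})/(q − q^{−1}). -/
noncomputable def qInt (q : ℂ) (k : ℕ) : ℂ := (q ^ k - q⁻¹ ^ k) / (q - q⁻¹)

/-- The q-factorial [k]_q!. -/
noncomputable def qFact (q : ℂ) : ℕ → ℂ
  | 0 => 1
  | k + 1 => qInt q (k + 1) * qFact q k

/-- The q-binomial coefficient [l ¦ n]_q. -/
noncomputable def qBinom (q : ℂ) (l n : ℕ) : ℂ := qFact q l / (qFact q (l - n) * qFact q n)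

/-- The set of down-spin positions of a basis state of (ℂ²)^{⊗l}. -/
def downs {l : ℕ} (σ : Fin l → Fin 2) : Finset (Fin l) := Finset.univ.filter fun j => σ j = 1

/-- The 1-based sum i₁ + ⋯ + i_n of down-spin positions. -/
def idxSum {l : ℕ} (σ : Fin l → Fin 2) : ℤ := ∑ j ∈ downs σ, ((j : ℕ) + 1 : ℤ)

/-- The vector ||l,n⟩ in coordinates: its coefficient on the basis state σ. -/
noncomputable def ketV (q : ℂ) (l n : ℕ) : (Fin l → Fin 2) → ℂ := fun σ =>
  if (downs σ).card = n then
    q ^ (idxSum σ - (n : ℤ) * (l : ℤ) + ((n * (n - 1) / 2 : ℕ) : ℤ)) else 0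

/-- The covector ⟨l,n|| in coordinates. -/
noncomputable def braV (q : ℂ) (l n : ℕ) : (Fin l → Fin 2) → ℂ := fun σ =>
  (qBinom q l n)⁻¹ * q ^ ((n : ℤ) * ((l : ℤ) - (n : ℤ))) *
    (if (downs σ).card = n then
      q ^ (idxSum σ - (n : ℤ) * (l : ℤ) + ((n * (n - 1) / 2 : ℕ) : ℤ)) else 0)

/-- The conjugate vector ||l,n⟩~ in coordinates. -/
noncomputable def ketTilde (q : ℂ) (l n : ℕ) : (Fin l → Fin 2) → ℂ := fun σ =>
  qBinom q l n * q ^ (-(n : ℤ) * ((l : ℤ) - (n : ℤ))) / (Nat.choose l n : ℂ) *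
    (if (downs σ).card = n then
      q ^ (-idxSum σ + (n : ℤ) * (l : ℤ) - ((n * (n - 1) / 2 : ℕ) : ℤ)) else 0)

/-- The projector P^{(l)} = Σ_n ||l,n⟩⟨l,n||. -/
noncomputable def projP (q : ℂ) (l : ℕ) : Matrix (Fin l → Fin 2) (Fin l → Fin 2) ℂ :=
  ∑ n ∈ Finset.range (l + 1), Matrix.vecMulVec (ketV q l n) (braV q l n)

/-- The projector P̃^{(l)} = Σ_n ||l,n⟩~ ⟨l,n||. -/
noncomputable def projPt (q : ℂ) (l : ℕ) : Matrix (Fin l → Fin 2) (Fin l → Fin 2) ℂ :=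
  ∑ n ∈ Finset.range (l + 1), Matrix.vecMulVec (ketTilde q l n) (braV q l n)

/-- The spin-1/2 elementary matrix e^{a,b} acting at tensor factor j of (ℂ²)^{⊗l}. -/
noncomputable def eMat (l : ℕ) (j : Fin l) (a b : Fin 2) :
    Matrix (Fin l → Fin 2) (Fin l → Fin 2) ℂ :=
  Matrix.of fun σ τ => if σ j = a ∧ τ j = b ∧ ∀ k, k ≠ j → σ k = τ k then 1 else 0

/-- The ordered product e₁^{ε'₁,ε₁} ⋯ e_l^{ε'_l,ε_l}. -/
noncomputable def eProd (l : ℕ) (ε' ε : Fin l → Fin 2) :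
    Matrix (Fin l → Fin 2) (Fin l → Fin 2) ℂ :=
  ((List.finRange l).map fun j => eMat l j (ε' j) (ε j)).prod

/-- The gauge matrix χ = diag(1,e^{w₁}) ⊗ ⋯ ⊗ diag(1,e^{w_l}). -/
noncomputable def chiMat (l : ℕ) (w : Fin l → ℂ) :
    Matrix (Fin l → Fin 2) (Fin l → Fin 2) ℂ :=
  Matrix.diagonal fun σ => ∏ j : Fin l, if σ j = 1 then Complex.exp (w j) else 1

theorem qInt_ne_zero {q : ℂ} (hq : q ≠ 0) {k : ℕ} (h1 : q ^ 2 ≠ 1) (hk : q ^ (2 * k) ≠ 1) :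
    qInt q k ≠ 0 := by
  unfold qInt
  refine div_ne_zero (fun h => hk ?_) (fun h => h1 ?_)
  · have hk0 : q ^ k ≠ 0 := pow_ne_zero _ hq
    rw [inv_pow, sub_eq_zero] at h
    rw [two_mul, pow_add]
    nth_rewrite 2 [h]
    exact mul_inv_cancel₀ hk0
  · rw [sub_eq_zero] at h
    rw [sq]
    nth_rewrite 2 [h]
    exact mul_inv_cancel₀ hq

theorem qFact_ne_zero {q : ℂ} (hq : q ≠ 0) {l : ℕ}
    (hroot : ∀ k : ℕ, 1 ≤ k → k ≤ l → q ^ (2 * k) ≠ 1) : ∀ k ≤ l, qFact q k ≠ 0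
  | 0, _ => one_ne_zero
  | k + 1, hk =>
    mul_ne_zero
      (qInt_ne_zero hq (hroot 1 le_rfl (by omega)) (hroot (k + 1) (by omega) hk))
      (qFact_ne_zero hq hroot k (by omega))

theorem qBinom_ne_zero {q : ℂ} (hq : q ≠ 0) {l : ℕ}
    (hroot : ∀ k : ℕ, 1 ≤ k → k ≤ l → q ^ (2 * k) ≠ 1) {n : ℕ} (hn : n ≤ l) :
    qBinom q l n ≠ 0 :=
  div_ne_zero (qFact_ne_zero hq hroot l le_rfl)
    (mul_ne_zero (qFact_ne_zero hq hroot _ (Nat.sub_le l n)) (qFact_ne_zero hq hroot n hn))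

/-- Entries of a product of elementary matrices over distinct tensor factors. -/
theorem prod_eMat_apply {l : ℕ} (ε' ε : Fin l → Fin 2) (L : List (Fin l)) (hL : L.Nodup)
    (σ τ : Fin l → Fin 2) :
    (L.map fun j => eMat l j (ε' j) (ε j)).prod σ τ =
      if ∀ k, if k ∈ L then σ k = ε' k ∧ τ k = ε k else σ k = τ k then 1 else 0 := by
  induction L generalizing σ with
  | nil =>
    simp [Matrix.one_apply, funext_iff]
  | cons a L ih =>
    obtain ⟨ha, hL⟩ := List.nodup_cons.mp hL
    rw [List.map_cons, List.prod_cons, Matrix.mul_apply,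
      Finset.sum_eq_single (Function.update σ a (ε a))]
    · rw [ih hL, eMat, Matrix.of_apply, ite_zero_mul_ite_zero, mul_one]
      congr 1
      rw [eq_iff_iff]
      constructor
      · rintro ⟨⟨h1, -, -⟩, h2⟩ k
        have := h2 k
        by_cases hk : k = a
        · subst hk
          simp_all
        · simp_all
      · intro h
        have hσ : σ a = ε' a ∧ τ a = ε a := by simpa using h a
        refine ⟨⟨hσ.1, by simp, fun k hk => by simp [hk]⟩, fun k => ?_⟩
        have := h k
        by_cases hk : k = a
        · subst hk
          simp_all
        · simp_all
    · intro ρ _ hρ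
      rw [eMat, Matrix.of_apply, if_neg, zero_mul]
      rintro ⟨-, h2, h3⟩
      refine hρ (funext fun k => ?_)
      by_cases hk : k = a
      · subst hk
        simpa using h2
      · simp [hk, h3 k hk]
    · simp

theorem eProd_eq_single {l : ℕ} (ε' ε : Fin l → Fin 2) :
    eProd l ε' ε = Matrix.single ε' ε 1 := by
  ext σ τ
  rw [eProd, prod_eMat_apply ε' ε _ (List.nodup_finRange l), Matrix.single_apply]
  congr 1
  simp [funext_iff, forall_and, eq_comm]

/-- Diagonal entries of the gauge matrix for `w_j = ξ − jη`. -/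
theorem prod_gauge_eq_exp {l : ℕ} {η ξ : ℂ} {w : Fin l → ℂ}
    (hw : ∀ j : Fin l, w j = ξ - ((j : ℕ) : ℂ) * η) (σ : Fin l → Fin 2) :
    (∏ j : Fin l, if σ j = 1 then Complex.exp (w j) else 1) =
      Complex.exp ((downs σ).card * (ξ + η) - idxSum σ * η) := by
  rw [← Finset.prod_filter, ← Complex.exp_sum, idxSum]
  congr 1
  push_cast
  rw [Finset.sum_mul, ← nsmul_eq_mul, ← Finset.sum_const, ← Finset.sum_sub_distrib]
  refine Finset.sum_congr rfl fun j _ => ?_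
  rw [hw]
  ring

theorem chiMat_inv {l : ℕ} (w : Fin l → ℂ) :
    (chiMat l w)⁻¹ =
      Matrix.diagonal fun σ => (∏ j : Fin l, if σ j = 1 then Complex.exp (w j) else 1)⁻¹ := by
  refine Matrix.inv_eq_right_inv ?_
  rw [chiMat, Matrix.diagonal_mul_diagonal, ← Matrix.diagonal_one]
  congr 1
  funext σ
  refine mul_inv_cancel₀ (Finset.prod_ne_zero_iff.mpr fun j _ => ?_)
  split_ifs
  · exact Complex.exp_ne_zero _
  · exact one_ne_zero

/-- Conjugating a sum of matrix units with common row by the gauge matrix. -/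
theorem sum_gauge_conj_apply {l : ℕ} (w : Fin l → ℂ) (ε' : Fin l → Fin 2)
    (s : Finset (Fin l → Fin 2)) (ρ τ : Fin l → Fin 2) :
    (∑ ε ∈ s, chiMat l w * eProd l ε' ε * (chiMat l w)⁻¹) ρ τ =
      if ρ = ε' ∧ τ ∈ s then
        (∏ j : Fin l, if ε' j = 1 then Complex.exp (w j) else 1) *
          (∏ j : Fin l, if τ j = 1 then Complex.exp (w j) else 1)⁻¹
      else 0 := by
  rw [Matrix.sum_apply, chiMat_inv]
  simp only [chiMat, eProd_eq_single, Matrix.mul_diagonal, Matrix.diagonal_mul,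
    Matrix.single_apply]
  by_cases hρ : ρ = ε'
  · subst hρ
    simp
  · simp [hρ, Ne.symm hρ]

theorem projPt_apply {q : ℂ} {l i : ℕ} (hi : i ≤ l) {ρ : Fin l → Fin 2}
    (hρ : (downs ρ).card = i) (σ : Fin l → Fin 2) :
    projPt q l σ ρ = ketTilde q l i σ * braV q l i ρ := by
  rw [projPt, Matrix.sum_apply, Finset.sum_eq_single i]
  · rfl
  · intro n _ hn
    rw [Matrix.vecMulVec_apply, braV, if_neg (by rw [hρ]; exact hn.symm), mul_zero, mul_zero]
  · intro h
    exact absurd (Finset.mem_range.mpr (by omega)) h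

theorem cast_mul_pred_div_two (n : ℕ) :
    ((n * (n - 1) / 2 : ℕ) : ℂ) = (n : ℂ) * ((n : ℂ) - 1) / 2 := by
  rw [← Nat.choose_two_right, Nat.cast_choose_two]

/-- The covector entry on a state with `n` down spins, as a single exponential. -/
theorem braV_exp {l n : ℕ} (η : ℂ) {σ : Fin l → Fin 2} (hσ : (downs σ).card = n) :
    braV (Complex.exp η) l n σ = (qBinom (Complex.exp η) l n)⁻¹ *
      Complex.exp ((idxSum σ - (n : ℂ) * ((n : ℂ) + 1) / 2) * η) := by
  rw [braV, if_pos hσ, mul_assoc, ← zpow_add₀ (Complex.exp_ne_zero η), ← Complex.exp_int_mul]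
  congr 2
  simp only [Int.cast_add, Int.cast_sub, Int.cast_mul, Int.cast_natCast, cast_mul_pred_div_two]
  ring

/-- Reduction of spin-l/2 Hermitian elementary matrices to spin-1/2 elementary matrices
(Proposition 2.1, square-root-free form). Here w_j = ξ₁ − jη for the 0-based j : Fin l. -/
theorem stmt3 (l : ℕ) (hl : 1 ≤ l) (η ξ₁ : ℂ) (q : ℂ) (hq : q = Complex.exp η)
    (hroot : ∀ k : ℕ, 1 ≤ k → k ≤ l → q ^ (2 * k) ≠ 1)
    (w : Fin l → ℂ) (hw : ∀ j : Fin l, w j = ξ₁ - ((j : ℕ) : ℂ) * η)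
    (i j : ℕ) (hi : i ≤ l) (hj : j ≤ l)
    (ε' : Fin l → Fin 2) (hε' : (downs ε').card = i) :
    Matrix.vecMulVec (ketTilde q l i) (braV q l j) =
      (qBinom q l i / qBinom q l j *
        Complex.exp (η * (((j : ℂ) * ((l : ℂ) - (j : ℂ)) - (i : ℂ) * ((l : ℂ) - (i : ℂ))) / 2)) *
        Complex.exp (-((i : ℂ) - (j : ℂ)) * (ξ₁ - ((l : ℂ) - 1) * η / 2))) •
      (projPt q l *
        ∑ ε ∈ Finset.univ.filter (fun ε : Fin l → Fin 2 => (downs ε).card = j),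
          chiMat l w * eProd l ε' ε * (chiMat l w)⁻¹) := by
  subst hq
  have hBi := qBinom_ne_zero (Complex.exp_ne_zero η) hroot hi
  ext σ τ
  rw [Matrix.smul_apply, Matrix.mul_apply, Finset.sum_eq_single ε', smul_eq_mul,
    sum_gauge_conj_apply, projPt_apply hi hε', Matrix.vecMulVec_apply]
  · by_cases hτ : (downs τ).card = j
    · rw [if_pos (by simp [hτ]), braV_exp η hτ, braV_exp η hε', prod_gauge_eq_exp hw,
        prod_gauge_eq_exp hw, hτ, hε', ← Complex.exp_neg]
      have key : Complex.exp ((idxSum τ - (j : ℂ) * ((j : ℂ) + 1) / 2) * η) =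
          Complex.exp
            (η * (((j : ℂ) * ((l : ℂ) - (j : ℂ)) - (i : ℂ) * ((l : ℂ) - (i : ℂ))) / 2)) *
          Complex.exp (-((i : ℂ) - (j : ℂ)) * (ξ₁ - ((l : ℂ) - 1) * η / 2)) *
          Complex.exp ((idxSum ε' - (i : ℂ) * ((i : ℂ) + 1) / 2) * η) *
          (Complex.exp ((i : ℂ) * (ξ₁ + η) - idxSum ε' * η) *
            Complex.exp (-((j : ℂ) * (ξ₁ + η) - idxSum τ * η))) := by
        simp only [← Complex.exp_add]
        congr 1
        ring
      rw [key]
      field_simp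
    · rw [if_neg (by simp [hτ]), braV, if_neg hτ]
      simp
  · intro ρ _ hρ
    rw [sum_gauge_conj_apply, if_neg (fun h => hρ h.1), mul_zero]
  · simp
end

section
/- Spin-1 instance of the reduction formula: Let η, ξ₁ ∈ ℂ, q = e^η with q² ≠ ±1. Set χ = diag(1,e^{ξ₁}) ⊗ diag(1,e^{ξ₁−η}) on ℂ² ⊗ ℂ². Then, as 4×4 matrices, ||2,1⟩~ ⟨2,1|| = P̃^{(2)} χ (e₁^{0,0} e₂^{1,1} + e₁^{0,1} e₂^{1,0}) χ^{−1}. -/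
open scoped BigOperators

/-- The product of the elementary matrices at the two sites is a matrix unit of `(ℂ²)^{⊗2}`. -/
lemma eMat_zero_mul_eMat_one (a b c d : Fin 2) :
    eMat 2 0 a b * eMat 2 1 c d = Matrix.single ![a, c] ![b, d] 1 := by
  ext σ τ
  rw [Matrix.mul_apply, Finset.sum_eq_single ![b, σ 1]]
  · simp [eMat, Matrix.single, funext_iff, Fin.forall_fin_two, eq_comm]
    grind
  · intro ρ _ hρ
    simp [eMat, funext_iff, Fin.forall_fin_two] at hρ ⊢
    grind
  · simp

/-- Conjugating a matrix unit by the gauge matrix rescales it. -/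
lemma chiMat_conj_single (l : ℕ) (w : Fin l → ℂ) (σ τ : Fin l → Fin 2) :
    chiMat l w * Matrix.single σ τ 1 * (chiMat l w)⁻¹ =
      Matrix.single σ τ ((∏ j, if σ j = 1 then Complex.exp (w j) else 1) /
        ∏ j, if τ j = 1 then Complex.exp (w j) else 1) := by
  have hne (ρ : Fin l → Fin 2) : (∏ j, if ρ j = 1 then Complex.exp (w j) else 1) ≠ 0 :=
    Finset.prod_ne_zero_iff.mpr fun j _ => by split_ifs <;> simp
  have hdet : IsUnit (chiMat l w).det := by
    rw [chiMat, Matrix.det_diagonal]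
    exact (Finset.prod_ne_zero_iff.mpr fun ρ _ => hne ρ).isUnit
  let := Matrix.invertibleOfIsUnitDet _ hdet
  rw [Matrix.mul_inv_eq_iff_eq_mul_of_invertible]
  ext ρ κ
  rw [chiMat, Matrix.diagonal_mul, Matrix.mul_diagonal]
  by_cases h : σ = ρ ∧ τ = κ
  · obtain ⟨rfl, rfl⟩ := h
    simp [hne]
  · simp [Matrix.single_apply_of_ne _ _ _ _ _ h]

/-- `P̃^{(2)}` sends `|01⟩` to a multiple of `||2,1⟩~`. -/
lemma projPt_two_mulVec_single (q : ℂ) :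
    (projPt q 2).mulVec (Pi.single ![0, 1] 1) = braV q 2 1 ![0, 1] • ketTilde q 2 1 := by
  have hcard : (downs (![0, 1] : Fin 2 → Fin 2)).card = 1 := by decide
  ext σ
  simp [projPt, Finset.sum_range_succ, Matrix.vecMulVec_apply, braV, hcard, mul_comm]

/-- The covector `⟨2,1||` is proportional to `⟨01| + q^{-1}⟨10|`. -/
lemma braV_two_one (q : ℂ) :
    braV q 2 1 = braV q 2 1 ![0, 1] • (Pi.single ![0, 1] 1 + Pi.single ![1, 0] q⁻¹) := by
  have h01 : (downs (![0, 1] : Fin 2 → Fin 2)).card = 1 := by decide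
  have h10 : (downs (![1, 0] : Fin 2 → Fin 2)).card = 1 := by decide
  have i01 : idxSum (![0, 1] : Fin 2 → Fin 2) = 2 := by decide
  have i10 : idxSum (![1, 0] : Fin 2 → Fin 2) = 1 := by decide
  ext σ
  have hσ : σ = ![0, 1] ∨ σ = ![1, 0] ∨
      ((downs σ).card ≠ 1 ∧ σ ≠ ![0, 1] ∧ σ ≠ ![1, 0]) := by
    revert σ; decide
  rcases hσ with rfl | rfl | ⟨h, h', h''⟩
  · simp
  · simp [braV, h01, h10, i01, i10]
  · simp [braV, h, h', h'']

/-- Spin-1 instance of the reduction formula: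
||2,1⟩~ ⟨2,1|| = P̃^{(2)} χ (e₁^{0,0} e₂^{1,1} + e₁^{0,1} e₂^{1,0}) χ^{−1}
with χ = diag(1,e^{ξ₁}) ⊗ diag(1,e^{ξ₁−η}). -/
theorem stmt4 (η ξ₁ : ℂ) (q : ℂ) (hq : q = Complex.exp η)
    (h1 : q ^ 2 ≠ 1) (h2 : q ^ 2 ≠ -1)
    (w : Fin 2 → ℂ) (hw0 : w 0 = ξ₁) (hw1 : w 1 = ξ₁ - η) :
    Matrix.vecMulVec (ketTilde q 2 1) (braV q 2 1) =
      projPt q 2 *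
        (chiMat 2 w *
          (eMat 2 0 0 0 * eMat 2 1 1 1 + eMat 2 0 0 1 * eMat 2 1 1 0) *
          (chiMat 2 w)⁻¹) := by
  have hratio : Complex.exp (ξ₁ - η) / Complex.exp ξ₁ = q⁻¹ := by
    rw [← Complex.exp_sub, hq, ← Complex.exp_neg]
    ring_nf
  have hconj : chiMat 2 w *
      (eMat 2 0 0 0 * eMat 2 1 1 1 + eMat 2 0 0 1 * eMat 2 1 1 0) * (chiMat 2 w)⁻¹ =
      Matrix.vecMulVec (Pi.single ![0, 1] 1)
        (Pi.single ![0, 1] 1 + Pi.single ![1, 0] q⁻¹) := by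
    rw [eMat_zero_mul_eMat_one, eMat_zero_mul_eMat_one, mul_add, add_mul,
      chiMat_conj_single, chiMat_conj_single]
    ext σ τ
    simp [hw0, hw1, hratio, Matrix.single_apply, Matrix.vecMulVec_apply, Pi.single_apply]
    grind
  rw [hconj, Matrix.mul_vecMulVec, projPt_two_mulVec_single, Matrix.smul_vecMulVec,
    ← Matrix.vecMulVec_smul, ← braV_two_one]
end

section
/- Hermiticity in the massless regime: let ℓ ≥ 1 and q = e^{iζ} with ζ ∈ ℝ and q^{2k} ≠ 1 for 1 ≤ k ≤ ℓ. Then for each 0 ≤ n ≤ ℓ the matrix ||ℓ,n⟩ ⟨ℓ,n||~ on (ℂ²)^{⊗ℓ} is Hermitian (equal to its conjugate transpose), and the projector P̃^{(ℓ)} = Σ_{n=0}^{ℓ} ||ℓ,n⟩~ ⟨ℓ,n|| is Hermitian. -/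
open scoped BigOperators

/-- The conjugate covector ⟨l,n||~ in coordinates. -/
noncomputable def braTilde (q : ℂ) (l n : ℕ) : (Fin l → Fin 2) → ℂ := fun σ =>
  ((Nat.choose l n : ℂ))⁻¹ *
    (if (downs σ).card = n then
      q ^ (-idxSum σ + (n : ℤ) * (l : ℤ) - ((n * (n - 1) / 2 : ℕ) : ℤ)) else 0)

/-- On the unit circle, conjugating `||l,n⟩` inverts its phases. -/
theorem star_ketV_apply {q : ℂ} (hq : star q = q⁻¹) (l n : ℕ) (σ : Fin l → Fin 2) :
    star (ketV q l n) σ = if (downs σ).card = n then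
      q ^ (-idxSum σ + (n : ℤ) * (l : ℤ) - ((n * (n - 1) / 2 : ℕ) : ℤ)) else 0 := by
  rw [Pi.star_apply, ketV]
  split_ifs
  · rw [star_zpow₀, hq, inv_zpow']
    congr 1
    ring
  · exact star_zero ℂ

theorem braTilde_eq_smul_star_ketV {q : ℂ} (hq : star q = q⁻¹) (l n : ℕ) :
    braTilde q l n = ((l.choose n : ℂ))⁻¹ • star (ketV q l n) := by
  ext σ
  rw [Pi.smul_apply, star_ketV_apply hq, smul_eq_mul, braTilde]

theorem ketTilde_eq_smul_star_ketV {q : ℂ} (hq : star q = q⁻¹) (l n : ℕ) :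
    ketTilde q l n =
      (qBinom q l n * q ^ (-(n : ℤ) * ((l : ℤ) - (n : ℤ))) / (l.choose n : ℂ)) •
        star (ketV q l n) := by
  ext σ
  rw [Pi.smul_apply, star_ketV_apply hq, smul_eq_mul, ketTilde]

theorem braV_eq_smul_ketV (q : ℂ) (l n : ℕ) :
    braV q l n =
      ((qBinom q l n)⁻¹ * q ^ ((n : ℤ) * ((l : ℤ) - (n : ℤ)))) • ketV q l n :=
  rfl

theorem isSelfAdjoint_mul_inv_self (z : ℂ) : IsSelfAdjoint (z * z⁻¹) := by
  rcases eq_or_ne z 0 with rfl | hz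
  · simp
  · simp [hz]

open scoped ComplexOrder in
theorem isHermitian_vecMulVec_ketV_braTilde {q : ℂ} (hq : star q = q⁻¹) (l n : ℕ) :
    (Matrix.vecMulVec (ketV q l n) (braTilde q l n)).IsHermitian := by
  rw [braTilde_eq_smul_star_ketV hq, Matrix.vecMulVec_smul]
  exact (Matrix.posSemidef_vecMulVec_self_star _).isHermitian.smul
    (IsSelfAdjoint.natCast _).inv₀

open scoped ComplexOrder in
theorem isHermitian_vecMulVec_ketTilde_braV {q : ℂ} (hq₀ : q ≠ 0) (hq : star q = q⁻¹)
    (l n : ℕ) : (Matrix.vecMulVec (ketTilde q l n) (braV q l n)).IsHermitian := by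
  have hcoeff : (qBinom q l n)⁻¹ * q ^ ((n : ℤ) * ((l : ℤ) - (n : ℤ))) *
      (qBinom q l n * q ^ (-(n : ℤ) * ((l : ℤ) - (n : ℤ))) / (l.choose n : ℂ)) =
      qBinom q l n * (qBinom q l n)⁻¹ * ((l.choose n : ℂ))⁻¹ := by
    have hpow := zpow_ne_zero ((n : ℤ) * ((l : ℤ) - (n : ℤ))) hq₀
    rw [neg_mul, zpow_neg]
    linear_combination qBinom q l n * (qBinom q l n)⁻¹ * ((l.choose n : ℂ))⁻¹ *
      mul_inv_cancel₀ hpow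
  rw [ketTilde_eq_smul_star_ketV hq, braV_eq_smul_ketV, Matrix.vecMulVec_smul,
    Matrix.smul_vecMulVec, smul_smul, hcoeff]
  exact (Matrix.posSemidef_vecMulVec_star_self _).isHermitian.smul
    ((isSelfAdjoint_mul_inv_self _).mul (IsSelfAdjoint.natCast _).inv₀)

/-- Hermiticity in the massless regime (q = e^{iζ}, ζ real): the matrices
||l,n⟩ ⟨l,n||~ and the projector P̃^{(l)} are Hermitian. -/
theorem stmt8 (l : ℕ) (hl : 1 ≤ l) (ζ : ℝ) (q : ℂ)
    (hq : q = Complex.exp (Complex.I * ζ))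
    (hroot : ∀ k : ℕ, 1 ≤ k → k ≤ l → q ^ (2 * k) ≠ 1) :
    (∀ n : ℕ, n ≤ l →
      (Matrix.vecMulVec (ketV q l n) (braTilde q l n)).conjTranspose =
        Matrix.vecMulVec (ketV q l n) (braTilde q l n)) ∧
    (projPt q l).conjTranspose = projPt q l := by
  have hq₀ : q ≠ 0 := hq ▸ Complex.exp_ne_zero _
  have hstar : star q = q⁻¹ := by
    rw [hq, ← Complex.exp_neg, Complex.star_def, ← Complex.exp_conj]
    simp
  refine ⟨fun n _ => isHermitian_vecMulVec_ketV_braTilde hstar l n, ?_⟩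
  rw [projPt, Matrix.conjTranspose_sum]
  exact Finset.sum_congr rfl fun n _ => isHermitian_vecMulVec_ketTilde_braV hq₀ hstar l n
end

section
/- Fusion projector for ℓ = 2 equals the spectral projector: let η ∈ ℂ with sinh η ≠ 0 and sinh 2η ≠ 0, and set q = e^η. Then, as 4×4 matrices on ℂ² ⊗ ℂ², Π · R⁺(η) = Σ_{n=0}^{2} ||2,n⟩⟨2,n||, where Π is the flip operator Π(u ⊗ v) = v ⊗ u. -/
open scoped BigOperators

/-- The asymmetric R-matrix R⁺(u) on ℂ² ⊗ ℂ², with entry (σ,τ) indexed by basis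
states σ, τ : Fin 2 → Fin 2 (ordered basis |00⟩,|01⟩,|10⟩,|11⟩). -/
noncomputable def Rplus2 (η u : ℂ) : Matrix (Fin 2 → Fin 2) (Fin 2 → Fin 2) ℂ :=
  Matrix.of fun σ τ =>
    if σ = τ then (if σ 0 = σ 1 then 1 else Complex.sinh u / Complex.sinh (u + η))
    else if τ 0 = σ 1 ∧ τ 1 = σ 0 ∧ σ 0 ≠ σ 1 then
      (if σ 0 = 0 then Complex.exp (-u) * Complex.sinh η / Complex.sinh (u + η)
       else Complex.exp u * Complex.sinh η / Complex.sinh (u + η))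
    else 0

/-- The flip operator Π(u ⊗ v) = v ⊗ u on ℂ² ⊗ ℂ². -/
noncomputable def flipMat : Matrix (Fin 2 → Fin 2) (Fin 2 → Fin 2) ℂ :=
  Matrix.of fun σ τ => if σ 0 = τ 1 ∧ σ 1 = τ 0 then 1 else 0

/-- Left multiplication by the flip swaps the tensor factors of the row index. -/
lemma flipMat_mul_apply (M : Matrix (Fin 2 → Fin 2) (Fin 2 → Fin 2) ℂ) (σ τ : Fin 2 → Fin 2) :
    (flipMat * M) σ τ = M ![σ 1, σ 0] τ := by
  rw [Matrix.mul_apply, Finset.sum_eq_single ![σ 1, σ 0]]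
  · simp [flipMat]
  · intro ρ _ hρ
    have : ¬ (σ 0 = ρ 1 ∧ σ 1 = ρ 0) := by
      rintro ⟨h0, h1⟩
      apply hρ
      ext i
      fin_cases i <;> simp [h0, h1]
    simp [flipMat, this]
  · simp

lemma sinh_eq_exp_sub_inv (η : ℂ) :
    Complex.sinh η = (Complex.exp η - (Complex.exp η)⁻¹) / 2 := by
  rw [Complex.sinh, Complex.exp_neg]

lemma qInt_one {q : ℂ} (h : q - q⁻¹ ≠ 0) : qInt q 1 = 1 := by
  simp [qInt, h]

lemma qInt_two {q : ℂ} (h : q - q⁻¹ ≠ 0) : qInt q 2 = q + q⁻¹ := by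
  rw [qInt, div_eq_iff h]
  ring

lemma qBinom_two_one {q : ℂ} (h : q - q⁻¹ ≠ 0) : qBinom q 2 1 = q + q⁻¹ := by
  simp [qBinom, qFact, qInt_one h, qInt_two h]

lemma qBinom_two_zero {q : ℂ} (h : q - q⁻¹ ≠ 0) (h' : q + q⁻¹ ≠ 0) : qBinom q 2 0 = 1 := by
  simp [qBinom, qFact, qInt_one h, qInt_two h, h']

lemma qBinom_two_two {q : ℂ} (h : q - q⁻¹ ≠ 0) (h' : q + q⁻¹ ≠ 0) : qBinom q 2 2 = 1 := by
  simp [qBinom, qFact, qInt_one h, qInt_two h, h']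

/-- Fusion projector for l = 2 equals the spectral projector:
Π R⁺(η) = Σ_{n=0}^{2} ||2,n⟩⟨2,n|| with q = e^η. -/
theorem stmt9 (η : ℂ) (h1 : Complex.sinh η ≠ 0) (h2 : Complex.sinh (2 * η) ≠ 0) :
    flipMat * Rplus2 η η =
      ∑ n ∈ Finset.range 3,
        Matrix.vecMulVec (ketV (Complex.exp η) 2 n) (braV (Complex.exp η) 2 n) := by
  have hq : Complex.exp η ≠ 0 := Complex.exp_ne_zero η
  have hsinh : Complex.sinh (η + η) =
      Complex.sinh η * (Complex.exp η + (Complex.exp η)⁻¹) := by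
    rw [sinh_eq_exp_sub_inv, sinh_eq_exp_sub_inv, Complex.exp_add, mul_inv]
    ring
  have hsub : Complex.exp η - (Complex.exp η)⁻¹ ≠ 0 := fun h => h1 (by
    rw [sinh_eq_exp_sub_inv, h, zero_div])
  have hadd : Complex.exp η + (Complex.exp η)⁻¹ ≠ 0 := fun h => h2 (by
    rw [two_mul, hsinh, h, mul_zero])
  have b0 := qBinom_two_zero hsub hadd
  have b1 := qBinom_two_one hsub
  have b2 := qBinom_two_two hsub hadd
  have d00 : downs ![0, 0] = ∅ := by decide
  have d01 : downs ![0, 1] = {1} := by decide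
  have d10 : downs ![1, 0] = {0} := by decide
  have d11 : downs ![1, 1] = {0, 1} := by decide
  ext σ τ
  obtain ⟨a, b, rfl⟩ : ∃ a b, σ = ![a, b] := ⟨σ 0, σ 1, by ext i; fin_cases i <;> rfl⟩
  obtain ⟨c, d, rfl⟩ : ∃ c d, τ = ![c, d] := ⟨τ 0, τ 1, by ext i; fin_cases i <;> rfl⟩
  rw [flipMat_mul_apply]
  simp only [Finset.sum_range_succ, Finset.sum_range_zero, Matrix.add_apply,
    Matrix.vecMulVec_apply, ketV, braV, b0, b1, b2, Rplus2, Matrix.of_apply, hsinh,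
    Complex.exp_neg]
  generalize Complex.exp η = q at *
  fin_cases a <;> fin_cases b <;> fin_cases c <;> fin_cases d <;>
    simp [d00, d01, d10, d11, idxSum] <;> field_simp
end

section
/- Yang–Baxter equation for the XXZ R-matrices: let η, λ₁, λ₂, λ₃ ∈ ℂ be such that sinh(λ₁−λ₂+η) ≠ 0, sinh(λ₁−λ₃+η) ≠ 0 and sinh(λ₂−λ₃+η) ≠ 0. Then on ℂ² ⊗ ℂ² ⊗ ℂ² one has R₁₂(λ₁−λ₂) R₁₃(λ₁−λ₃) R₂₃(λ₂−λ₃) = R₂₃(λ₂−λ₃) R₁₃(λ₁−λ₃) R₁₂(λ₁−λ₂), where R may be taken to be either the asymmetric R-matrix R⁺ or the symmetric R-matrix R^{(p)}. -/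
/-- Generic XXZ-type R-matrix on ℂ² ⊗ ℂ² (ordered basis |00⟩,|01⟩,|10⟩,|11⟩) with
diagonal middle-block entry `bv` and off-diagonal entries `cm` (at (|01⟩,|10⟩)) and
`cp` (at (|10⟩,|01⟩)). -/
noncomputable def Rgen (bv cp cm : ℂ) : Matrix (Fin 2 × Fin 2) (Fin 2 × Fin 2) ℂ :=
  Matrix.of fun p r =>
    if p = r then (if p.1 = p.2 then 1 else bv)
    else if r.1 = p.2 ∧ r.2 = p.1 ∧ p.1 ≠ p.2 then (if p.1 = 0 then cm else cp)
    else 0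

/-- The asymmetric R-matrix R⁺(u). -/
noncomputable def Rplus (η u : ℂ) : Matrix (Fin 2 × Fin 2) (Fin 2 × Fin 2) ℂ :=
  Rgen (Complex.sinh u / Complex.sinh (u + η))
    (Complex.exp u * Complex.sinh η / Complex.sinh (u + η))
    (Complex.exp (-u) * Complex.sinh η / Complex.sinh (u + η))

/-- The symmetric R-matrix R^{(p)}(u). -/
noncomputable def Rsym (η u : ℂ) : Matrix (Fin 2 × Fin 2) (Fin 2 × Fin 2) ℂ :=
  Rgen (Complex.sinh u / Complex.sinh (u + η))
    (Complex.sinh η / Complex.sinh (u + η))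
    (Complex.sinh η / Complex.sinh (u + η))

/-- An operator on ℂ² ⊗ ℂ² acting on factors 1 and 2 of ℂ² ⊗ ℂ² ⊗ ℂ². -/
noncomputable def emb12 (A : Matrix (Fin 2 × Fin 2) (Fin 2 × Fin 2) ℂ) :
    Matrix (Fin 2 × Fin 2 × Fin 2) (Fin 2 × Fin 2 × Fin 2) ℂ :=
  Matrix.of fun p r => A (p.1, p.2.1) (r.1, r.2.1) * (if p.2.2 = r.2.2 then 1 else 0)

/-- An operator on ℂ² ⊗ ℂ² acting on factors 1 and 3 of ℂ² ⊗ ℂ² ⊗ ℂ². -/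
noncomputable def emb13 (A : Matrix (Fin 2 × Fin 2) (Fin 2 × Fin 2) ℂ) :
    Matrix (Fin 2 × Fin 2 × Fin 2) (Fin 2 × Fin 2 × Fin 2) ℂ :=
  Matrix.of fun p r => A (p.1, p.2.2) (r.1, r.2.2) * (if p.2.1 = r.2.1 then 1 else 0)

/-- An operator on ℂ² ⊗ ℂ² acting on factors 2 and 3 of ℂ² ⊗ ℂ² ⊗ ℂ². -/
noncomputable def emb23 (A : Matrix (Fin 2 × Fin 2) (Fin 2 × Fin 2) ℂ) :
    Matrix (Fin 2 × Fin 2 × Fin 2) (Fin 2 × Fin 2 × Fin 2) ℂ :=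
  Matrix.of fun p r => (if p.1 = r.1 then 1 else 0) * A p.2 r.2

set_option maxHeartbeats 4000000 in
-- The 64 matrix entries are expanded one at a time.
/-- Scalar relations between the weights that imply the Yang–Baxter equation for six-vertex
R-matrices of the form `Rgen`. -/
theorem Rgen_yangBaxter_of_weights (a p m b q n c r s : ℂ)
    (hs : b * s = s * a + c * n * p) (hr : b * r = a * r + m * q * c)
    (hm : b * m = c * m + r * n * a) (hp : b * p = c * p + a * q * s)
    (hn : n = s * m + c * n * a) (hq : q = a * q * c + p * r)
    (hbal : m * q * s = r * n * p) :
    emb12 (Rgen a p m) * emb13 (Rgen b q n) * emb23 (Rgen c r s) =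
      emb23 (Rgen c r s) * emb13 (Rgen b q n) * emb12 (Rgen a p m) := by
  ext ⟨i, j, k⟩ ⟨i', j', k'⟩
  fin_cases i <;> fin_cases j <;> fin_cases k <;> fin_cases i' <;> fin_cases j' <;>
    fin_cases k' <;>
    simp [emb12, emb13, emb23, Rgen, Matrix.mul_apply, Fintype.sum_prod_type] <;>
    first
    | ring1
    | linear_combination hs
    | linear_combination -hs
    | linear_combination hr
    | linear_combination -hr
    | linear_combination hm
    | linear_combination -hm
    | linear_combination hp
    | linear_combination -hp
    | linear_combination hn
    | linear_combination -hn
    | linear_combination hq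
    | linear_combination -hq
    | linear_combination hbal
    | linear_combination -hbal

/-- The Yang–Baxter equation survives rescaling the off-diagonal weights of the symmetric
R-matrices by a multiplicative gauge `x`, `x * y`, `y`. -/
theorem Rgen_yangBaxter_of_gauge (a p b q c r x y : ℂ) (hx : x ≠ 0) (hy : y ≠ 0)
    (hr : b * r = a * r + c * q * p) (hp : b * p = c * p + a * q * r)
    (hq : q = r * p + c * q * a) :
    emb12 (Rgen a (x * p) (x⁻¹ * p)) * emb13 (Rgen b (x * y * q) ((x * y)⁻¹ * q)) *
        emb23 (Rgen c (y * r) (y⁻¹ * r)) =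
      emb23 (Rgen c (y * r) (y⁻¹ * r)) * emb13 (Rgen b (x * y * q) ((x * y)⁻¹ * q)) *
        emb12 (Rgen a (x * p) (x⁻¹ * p)) := by
  apply Rgen_yangBaxter_of_weights <;> field_simp
  · linear_combination hr
  · linear_combination hr
  · linear_combination hp
  · linear_combination hp
  · linear_combination hq
  · linear_combination hq

theorem sinh_add_mul_sinh_add_right (u v w : ℂ) :
    Complex.sinh (u + v) * Complex.sinh (u + w) =
      Complex.sinh u * Complex.sinh (u + v + w) + Complex.sinh v * Complex.sinh w := by
  simp only [Complex.sinh_add, Complex.cosh_add]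
  linear_combination (Complex.sinh v * Complex.sinh w) * Complex.cosh_sq u

/-- The Yang–Baxter equation for the trigonometric six-vertex weights in an arbitrary
multiplicative gauge. -/
theorem Rgen_sinh_yangBaxter (η u v x y : ℂ) (hx : x ≠ 0) (hy : y ≠ 0)
    (hu : Complex.sinh (u + η) ≠ 0) (hv : Complex.sinh (v + η) ≠ 0)
    (huv : Complex.sinh (u + v + η) ≠ 0) :
    let R (t z : ℂ) := Rgen (Complex.sinh t / Complex.sinh (t + η))
      (z * (Complex.sinh η / Complex.sinh (t + η)))
      (z⁻¹ * (Complex.sinh η / Complex.sinh (t + η)))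
    emb12 (R u x) * emb13 (R (u + v) (x * y)) * emb23 (R v y) =
      emb23 (R v y) * emb13 (R (u + v) (x * y)) * emb12 (R u x) := by
  intro R
  have e₁ := sinh_add_mul_sinh_add_right u v η
  have e₂ := sinh_add_mul_sinh_add_right v u η
  have e₃ := sinh_add_mul_sinh_add_right η u v
  rw [add_comm v u] at e₂
  rw [add_comm η u, add_comm η v, add_right_comm] at e₃
  apply Rgen_yangBaxter_of_gauge <;> first | assumption | field_simp
  · linear_combination Complex.sinh η * e₁
  · linear_combination Complex.sinh η * e₂
  · linear_combination Complex.sinh η * e₃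

/-- Yang–Baxter equation for the asymmetric and symmetric XXZ R-matrices. -/
theorem stmt10 (η l₁ l₂ l₃ : ℂ)
    (h12 : Complex.sinh (l₁ - l₂ + η) ≠ 0)
    (h13 : Complex.sinh (l₁ - l₃ + η) ≠ 0)
    (h23 : Complex.sinh (l₂ - l₃ + η) ≠ 0) :
    (emb12 (Rplus η (l₁ - l₂)) * emb13 (Rplus η (l₁ - l₃)) * emb23 (Rplus η (l₂ - l₃)) =
      emb23 (Rplus η (l₂ - l₃)) * emb13 (Rplus η (l₁ - l₃)) * emb12 (Rplus η (l₁ - l₂))) ∧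
    (emb12 (Rsym η (l₁ - l₂)) * emb13 (Rsym η (l₁ - l₃)) * emb23 (Rsym η (l₂ - l₃)) =
      emb23 (Rsym η (l₂ - l₃)) * emb13 (Rsym η (l₁ - l₃)) * emb12 (Rsym η (l₁ - l₂))) := by
  have h13' : Complex.sinh (l₁ - l₂ + (l₂ - l₃) + η) ≠ 0 := by
    rwa [sub_add_sub_cancel]
  constructor
  · have h := Rgen_sinh_yangBaxter η (l₁ - l₂) (l₂ - l₃) (Complex.exp (l₁ - l₂))
      (Complex.exp (l₂ - l₃)) (Complex.exp_ne_zero _) (Complex.exp_ne_zero _) h12 h23 h13'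
    simpa only [Rplus, ← Complex.exp_add, ← Complex.exp_neg, sub_add_sub_cancel, mul_div_assoc]
      using h
  · have h := Rgen_sinh_yangBaxter η (l₁ - l₂) (l₂ - l₃) 1 1 one_ne_zero one_ne_zero h12 h23 h13'
    simpa only [Rsym, inv_one, one_mul, sub_add_sub_cancel] using h
end

section
/- Evaluation of the residue integral J₂ (Section 6.1): for every real ζ with 0 < ζ < π, (π/(4ζ² sin ζ)) ∫_ℝ (cosh 2x − cos ζ)/cosh²(πx/ζ) dx = (ζ − sin ζ cos ζ)/(2ζ sin² ζ). -/
open MeasureTheory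

namespace Real

lemma sigmoid_mul_one_sub_sigmoid (t : ℝ) :
    sigmoid t * (1 - sigmoid t) = 1 / (4 * cosh (t / 2) ^ 2) := by
  have hx : exp (-t) = exp (-(t / 2)) ^ 2 := by rw [← exp_nat_mul]; congr 1; push_cast; ring
  have hy : exp (t / 2) = (exp (-(t / 2)))⁻¹ := by rw [exp_neg, inv_inv]
  rw [← sigmoid_neg, ← sigmoid_mul_rexp_neg, sigmoid_def, cosh_eq, hx, hy]
  have := exp_pos (-(t / 2))
  field_simp
  ring

lemma sigmoid_rpow_mul_one_sub_sigmoid_rpow_neg (b t : ℝ) :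
    sigmoid t ^ b * (1 - sigmoid t) ^ (-b) = exp (b * t) := by
  have hs := sigmoid_pos t
  rw [← sigmoid_neg, ← sigmoid_mul_rexp_neg, mul_rpow hs.le (exp_pos _).le, ← mul_assoc,
    ← rpow_add hs, add_neg_cancel, rpow_zero, one_mul, ← exp_mul]
  congr 1
  ring

lemma abs_deriv_sigmoid_smul_beta_integrand (b t : ℝ) :
    |sigmoid t * (1 - sigmoid t)| •
      ((sigmoid t : ℂ) ^ ((1 + b : ℂ) - 1) * (1 - (sigmoid t : ℂ)) ^ ((1 - b : ℂ) - 1)) =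
    ((exp (b * t) / (4 * cosh (t / 2) ^ 2) : ℝ) : ℂ) := by
  have hs := sigmoid_pos t
  have hs' : 0 < 1 - sigmoid t := sub_pos.2 (sigmoid_lt_one t)
  have h1 : (1 + b : ℂ) - 1 = (b : ℝ) := by ring
  have h2 : (1 - b : ℂ) - 1 = ((-b : ℝ) : ℂ) := by push_cast; ring
  have h3 : (1 - (sigmoid t : ℂ)) = ((1 - sigmoid t : ℝ) : ℂ) := by push_cast; ring
  rw [abs_of_pos (mul_pos hs hs'), h1, h2, h3, ← Complex.ofReal_cpow hs.le,
    ← Complex.ofReal_cpow hs'.le, Complex.real_smul, ← Complex.ofReal_mul, ← Complex.ofReal_mul,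
    sigmoid_rpow_mul_one_sub_sigmoid_rpow_neg, sigmoid_mul_one_sub_sigmoid,
    one_div_mul_eq_div]

lemma integrable_exp_mul_div_cosh_sq {b : ℝ} (hb : |b| < 1) :
    Integrable fun t : ℝ ↦ exp (b * t) / (4 * cosh (t / 2) ^ 2) := by
  obtain ⟨hl, hr⟩ := abs_lt.1 hb
  have hconv := Complex.betaIntegral_convergent (u := 1 + b) (v := 1 - b)
    (by simp; linarith) (by simp; linarith)
  rw [intervalIntegrable_iff_integrableOn_Ioo_of_le zero_le_one, ← range_sigmoid,
    ← Set.image_univ, integrableOn_image_iff_integrableOn_abs_deriv_smul MeasurableSet.univ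
      (fun t _ ↦ (hasDerivAt_sigmoid t).hasDerivWithinAt) sigmoid_injective.injOn,
    integrableOn_univ] at hconv
  simp_rw [abs_deriv_sigmoid_smul_beta_integrand] at hconv
  exact hconv.re

lemma integral_exp_mul_div_cosh_sq {b : ℝ} (hb : |b| < 1) :
    ∫ t : ℝ, exp (b * t) / (4 * cosh (t / 2) ^ 2) = Gamma (1 + b) * Gamma (1 - b) := by
  obtain ⟨hl, hr⟩ := abs_lt.1 hb
  have hbeta := Complex.betaIntegral_eq_Gamma_mul_div (1 + b) (1 - b)
    (by simp; linarith) (by simp; linarith)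
  rw [Complex.betaIntegral, intervalIntegral.integral_of_le zero_le_one,
    integral_Ioc_eq_integral_Ioo, ← range_sigmoid,
    ← Set.image_univ, integral_image_eq_integral_abs_deriv_smul MeasurableSet.univ
      (fun t _ ↦ (hasDerivAt_sigmoid t).hasDerivWithinAt) sigmoid_injective.injOn,
    setIntegral_univ] at hbeta
  simp_rw [abs_deriv_sigmoid_smul_beta_integrand] at hbeta
  have h2 : (1 + b : ℂ) + (1 - b) = 2 := by ring
  have h3 : (1 + b : ℂ) = ((1 + b : ℝ) : ℂ) := by push_cast; ring
  have h4 : (1 - b : ℂ) = ((1 - b : ℝ) : ℂ) := by push_cast; ring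
  rw [integral_complex_ofReal, h2, Complex.Gamma_ofNat_eq_factorial, h3, h4, Complex.Gamma_ofReal,
    Complex.Gamma_ofReal] at hbeta
  norm_num at hbeta
  exact_mod_cast hbeta

lemma Gamma_one_add_mul_Gamma_one_sub {b : ℝ} (hb : b ≠ 0) :
    Gamma (1 + b) * Gamma (1 - b) = π * b / sin (π * b) := by
  rw [add_comm, Gamma_add_one hb, mul_assoc, Gamma_mul_Gamma_one_sub]
  ring

end Real

/-- Evaluation of the residue integral J₂ (Section 6.1):
(π/(4ζ² sin ζ)) ∫_ℝ (cosh 2x − cos ζ)/cosh²(πx/ζ) dx = (ζ − sin ζ cos ζ)/(2ζ sin² ζ). -/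
theorem stmt18 (ζ : ℝ) (h0 : 0 < ζ) (h1 : ζ < Real.pi) :
    Real.pi / (4 * ζ ^ 2 * Real.sin ζ) *
      ∫ x : ℝ, (Real.cosh (2 * x) - Real.cos ζ) / Real.cosh (Real.pi * x / ζ) ^ 2
    = (ζ - Real.sin ζ * Real.cos ζ) / (2 * ζ * Real.sin ζ ^ 2) := by
  have hπ := Real.pi_pos
  have hsin := Real.sin_pos_of_pos_of_lt_pi h0 h1
  set b := ζ / Real.pi with hb
  have hb0 : 0 < b := by positivity
  have hbabs : |b| < 1 := by rw [abs_of_pos hb0, hb, div_lt_one hπ]; exact h1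
  have hbneg : |-b| < 1 := by rwa [abs_neg]
  have hzero : |(0 : ℝ)| < 1 := by simp
  have hζ : Real.pi * b = ζ := by rw [hb]; field_simp
  let F : ℝ → ℝ → ℝ := fun c t ↦ Real.exp (c * t) / (4 * Real.cosh (t / 2) ^ 2)
  have hintegrand : ∀ x : ℝ,
      (Real.cosh (2 * x) - Real.cos ζ) / Real.cosh (Real.pi * x / ζ) ^ 2 =
      (fun t ↦ 2 * (F b t + F (-b) t) - 4 * Real.cos ζ * F 0 t) (2 * Real.pi / ζ * x) := by
    intro x
    have e1 : b * (2 * Real.pi / ζ * x) = 2 * x := by rw [hb]; field_simp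
    have e2 : 2 * Real.pi / ζ * x / 2 = Real.pi * x / ζ := by ring
    simp only [F, neg_mul, e1, e2, zero_mul, Real.exp_zero]
    rw [Real.cosh_eq (2 * x)]
    have := Real.cosh_pos (Real.pi * x / ζ)
    field_simp
    ring
  have iF : ∀ {c : ℝ}, |c| < 1 → Integrable (F c) := Real.integrable_exp_mul_div_cosh_sq
  have vF : ∀ {c : ℝ}, |c| < 1 → ∫ t, F c t = Real.Gamma (1 + c) * Real.Gamma (1 - c) :=
    Real.integral_exp_mul_div_cosh_sq
  have hsum : Integrable fun t ↦ 2 * (F b t + F (-b) t) :=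
    ((iF hbabs).add (iF hbneg)).const_mul 2
  simp_rw [hintegrand]
  rw [Measure.integral_comp_mul_left (fun t ↦ 2 * (F b t + F (-b) t) - 4 * Real.cos ζ * F 0 t),
    integral_sub hsum ((iF hzero).const_mul _),
    integral_const_mul, integral_const_mul, integral_add (iF hbabs) (iF hbneg),
    vF hbabs, vF hbneg, vF hzero, Real.Gamma_one_add_mul_Gamma_one_sub hb0.ne',
    Real.Gamma_one_add_mul_Gamma_one_sub (neg_ne_zero.2 hb0.ne'), mul_neg, Real.sin_neg, hζ,
    neg_div_neg_eq, add_zero, sub_zero, Real.Gamma_one, abs_of_pos (by positivity), smul_eq_mul]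
  field_simp
  ring
end

section
/- Contour-shift identity for the density-weighted sinh ratios (K₂ = I₁, Sections 6.2–6.3): for every real ζ with 0 < ζ < π/2, ∫_ℝ ρ(x) sinh(x + iζ/2)/sinh(x + 3iζ/2) dx = − ∫_ℝ ρ(x) sinh(x − iζ/2)/sinh(x + iζ/2) dx, where ρ(x) = 1/(2ζ cosh(πx/ζ)). -/
open MeasureTheory

/-- The density of string centers. -/
noncomputable def rho (ζ x : ℝ) : ℝ := 1 / (2 * ζ * Real.cosh (Real.pi * x / ζ))

open Filter Topology

theorem norm_sinh_sq (w : ℂ) :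
    ‖Complex.sinh w‖ ^ 2 = Real.sinh w.re ^ 2 + Real.sin w.im ^ 2 := by
  have h : Complex.sinh w = ((Real.sinh w.re * Real.cos w.im : ℝ) : ℂ) +
      ((Real.cosh w.re * Real.sin w.im : ℝ) : ℂ) * Complex.I := by
    conv_lhs => rw [← Complex.re_add_im w, Complex.sinh_add, Complex.sinh_mul_I, Complex.cosh_mul_I]
    push_cast
    ring
  rw [Complex.sq_norm, h, Complex.normSq_add_mul_I]
  linear_combination Real.sin w.im ^ 2 * Real.cosh_sq w.re +
    Real.sinh w.re ^ 2 * Real.sin_sq_add_cos_sq w.im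

theorem abs_sinh_re_le_norm_sinh (w : ℂ) : |Real.sinh w.re| ≤ ‖Complex.sinh w‖ := by
  refine abs_le_of_sq_le_sq ?_ (norm_nonneg _)
  rw [norm_sinh_sq]
  exact le_add_of_nonneg_right (sq_nonneg _)

theorem norm_sinh_le_abs_sinh_re_add_one (w : ℂ) :
    ‖Complex.sinh w‖ ≤ |Real.sinh w.re| + 1 := by
  refine (sq_le_sq₀ (norm_nonneg _) (by positivity)).1 ?_
  rw [norm_sinh_sq, add_sq, sq_abs]
  nlinarith [Real.sin_sq_le_one w.im, abs_nonneg (Real.sinh w.re)]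

theorem sinh_ne_zero_of_sin_im_ne_zero {w : ℂ} (h : Real.sin w.im ≠ 0) :
    Complex.sinh w ≠ 0 := by
  intro h0
  have := norm_sinh_sq w
  rw [h0, norm_zero] at this
  nlinarith [sq_nonneg (Real.sinh w.re), pow_pos (abs_pos.2 h) 2, sq_abs (Real.sin w.im)]

theorem sinh_ne_zero_of_abs_im_lt_pi {w : ℂ} (hw : w ≠ 0) (h : |w.im| < Real.pi) :
    Complex.sinh w ≠ 0 := by
  rw [abs_lt] at h
  by_cases him : w.im = 0
  · have hre : w.re ≠ 0 := fun hre => hw (Complex.ext hre him)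
    rw [← norm_pos_iff]
    exact (abs_pos.2 (Real.sinh_ne_zero.2 hre)).trans_le (abs_sinh_re_le_norm_sinh w)
  · exact sinh_ne_zero_of_sin_im_ne_zero
      (fun hs => him ((Real.sin_eq_zero_iff_of_lt_of_lt h.1 h.2).1 hs))

theorem two_mul_sq_le_abs_sinh_mul {r x : ℝ} (hr : 2 ≤ r) :
    2 * x ^ 2 ≤ |Real.sinh (r * x)| := by
  rw [Real.abs_sinh, abs_mul, abs_of_nonneg (by linarith : 0 ≤ r), ← sq_abs x]
  have hx := abs_nonneg x
  refine le_trans ?_ (Real.sinh_le_sinh.2 (mul_le_mul_of_nonneg_right hr hx))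
  rw [Real.sinh_two_mul]
  have hs := Real.self_le_sinh_iff.2 hx
  nlinarith [Real.sinh_lt_cosh |x|]

/-- Shifting a horizontal contour across a strip on which the integrand is holomorphic and decays
quadratically. -/
theorem integral_horizontal_line_eq {f : ℂ → ℂ} {a b C : ℝ}
    (hd : DifferentiableOn ℂ f {z | z.im ∈ Set.uIcc a b})
    (hC : ∀ z : ℂ, z.im ∈ Set.uIcc a b → 1 ≤ |z.re| → ‖f z‖ ≤ C / z.re ^ 2) :
    ∫ x : ℝ, f (x + a * Complex.I) = ∫ x : ℝ, f (x + b * Complex.I) := by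
  have hintegrable : ∀ c ∈ Set.uIcc a b, Integrable (fun x : ℝ => f (x + c * Complex.I)) := by
    intro c hc
    have hcont : Continuous (fun x : ℝ => f (x + c * Complex.I)) :=
      hd.continuousOn.comp_continuous (by fun_prop) (fun x => by simpa using hc)
    refine hcont.locallyIntegrable.integrable_of_isBigO_cocompact ?_
      (integrable_inv_one_add_sq.integrableAtFilter _)
    refine Asymptotics.IsBigO.of_bound (2 * |C|) ?_
    have hlarge : ∀ᶠ x : ℝ in cocompact ℝ, 1 ≤ |x| :=
      (tendsto_norm_cocompact_atTop (E := ℝ)).eventually_ge_atTop 1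
    filter_upwards [hlarge] with x hx
    have hx2 : 1 ≤ x ^ 2 := by rw [← sq_abs]; nlinarith
    have h := hC (x + c * Complex.I) (by simpa using hc) (by simpa using hx)
    have hre : ((x : ℂ) + c * Complex.I).re = x := by simp
    rw [hre] at h
    refine h.trans ?_
    rw [norm_inv, Real.norm_of_nonneg (by positivity : (0 : ℝ) ≤ 1 + x ^ 2), ← div_eq_mul_inv,
      div_le_div_iff₀ (by positivity) (by positivity)]
    nlinarith [le_abs_self C, abs_nonneg C]
  have hvert : ∀ s : ℝ, |s| = 1 →
      Tendsto (fun T : ℝ => ∫ y : ℝ in a..b, f ((s * T : ℝ) + y * Complex.I)) atTop (𝓝 0) := by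
    intro s hs
    have hlim : Tendsto (fun T : ℝ => C / T ^ 2 * |b - a|) atTop (𝓝 0) := by
      simpa using (tendsto_const_nhds.div_atTop (tendsto_pow_atTop two_ne_zero)).mul_const |b - a|
    refine squeeze_zero_norm' ?_ hlim
    filter_upwards [eventually_ge_atTop 1] with T hT
    refine intervalIntegral.norm_integral_le_of_norm_le_const fun y hy => ?_
    have hre : (((s * T : ℝ) : ℂ) + y * Complex.I).re = s * T := by simp
    have h := hC ((s * T : ℝ) + y * Complex.I) (by simpa using Set.uIoc_subset_uIcc hy)
      (by rw [hre, abs_mul, hs, one_mul]; exact hT.trans (le_abs_self T))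
    rwa [hre, mul_pow, ← sq_abs s, hs, one_pow, one_mul] at h
  have hlimit := (((intervalIntegral_tendsto_integral (hintegrable a Set.left_mem_uIcc)
    tendsto_neg_atTop_atBot tendsto_id).sub (intervalIntegral_tendsto_integral
    (hintegrable b Set.right_mem_uIcc) tendsto_neg_atTop_atBot tendsto_id)).add
    ((hvert 1 (by simp)).const_smul Complex.I)).sub ((hvert (-1) (by simp)).const_smul Complex.I)
  have hzero := tendsto_nhds_unique (hlimit.congr (f₂ := fun _ => 0) fun T => ?_)
    tendsto_const_nhds
  · simpa [sub_eq_zero] using hzero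
  · have h := Complex.integral_boundary_rect_eq_zero_of_differentiableOn f
      ⟨-T, a⟩ ⟨T, b⟩ (hd.mono fun z hz => hz.2)
    simpa using h

/-- The entire function extending `sinh z / z`. -/
noncomputable def sinhc : ℂ → ℂ := dslope Complex.sinh 0

theorem differentiable_sinhc : Differentiable ℂ sinhc := by
  rw [← differentiableOn_univ]
  exact (Complex.differentiableOn_dslope univ_mem).2 Complex.differentiable_sinh.differentiableOn

theorem sinhc_of_ne_zero {w : ℂ} (hw : w ≠ 0) : sinhc w = Complex.sinh w / w := by
  rw [sinhc, dslope_of_ne _ hw, slope_def_field]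
  simp

theorem sinhc_ne_zero_of_abs_im_lt_pi {w : ℂ} (h : |w.im| < Real.pi) : sinhc w ≠ 0 := by
  by_cases hw : w = 0
  · simp [hw, sinhc, dslope_same]
  · rw [sinhc_of_ne_zero hw]
    exact div_ne_zero (sinh_ne_zero_of_abs_im_lt_pi hw h) hw

/-- The holomorphic continuation of the density-weighted ratio of hyperbolic sines, centred so that
the relevant strip is symmetric about the real axis. -/
noncomputable def weightedSinhRatio (ζ : ℝ) (w : ℂ) : ℂ :=
  Complex.I / (2 * Real.pi) *
    (sinhc w / sinhc ((Real.pi / ζ : ℝ) * w) / Complex.sinh (w + ζ * Complex.I))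

theorem weightedSinhRatio_of_ne_zero {ζ : ℝ} (hζ : ζ ≠ 0) {w : ℂ} (hw : w ≠ 0) :
    weightedSinhRatio ζ w = Complex.I / (2 * ζ) * (Complex.sinh w /
      Complex.sinh ((Real.pi / ζ : ℝ) * w) / Complex.sinh (w + ζ * Complex.I)) := by
  have hπ : (Real.pi : ℂ) ≠ 0 := by exact_mod_cast Real.pi_ne_zero
  have hζ' : (ζ : ℂ) ≠ 0 := by exact_mod_cast hζ
  have hr : ((Real.pi / ζ : ℝ) : ℂ) ≠ 0 := by exact_mod_cast div_ne_zero Real.pi_ne_zero hζ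
  rw [weightedSinhRatio, sinhc_of_ne_zero hw, sinhc_of_ne_zero (mul_ne_zero hr hw)]
  generalize Complex.sinh ((Real.pi / ζ : ℝ) * w) = s
  generalize Complex.sinh (w + ζ * Complex.I) = t
  push_cast
  field_simp

theorem differentiableOn_weightedSinhRatio {ζ : ℝ} (h0 : 0 < ζ) (h1 : ζ < Real.pi / 2) :
    DifferentiableOn ℂ (weightedSinhRatio ζ) {z | z.im ∈ Set.uIcc (ζ / 2) (-(ζ / 2))} := by
  intro z hz
  rw [Set.mem_ofPred_eq, Set.uIcc_of_ge (by linarith), Set.mem_Icc] at hz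
  have hden : sinhc ((Real.pi / ζ : ℝ) * z) ≠ 0 := by
    apply sinhc_ne_zero_of_abs_im_lt_pi
    rw [Complex.im_ofReal_mul, abs_mul, abs_of_pos (div_pos Real.pi_pos h0), div_mul_eq_mul_div,
      div_lt_iff₀ h0]
    exact mul_lt_mul_of_pos_left (abs_lt.2 ⟨by linarith [hz.1], by linarith [hz.2]⟩) Real.pi_pos
  have hsinh : Complex.sinh (z + ζ * Complex.I) ≠ 0 := by
    apply sinh_ne_zero_of_sin_im_ne_zero
    have him : (z + ζ * Complex.I).im = z.im + ζ := by simp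
    rw [him]
    exact (Real.sin_pos_of_pos_of_lt_pi (by linarith [hz.1]) (by linarith [hz.2])).ne'
  have hd := differentiable_sinhc
  refine DifferentiableAt.differentiableWithinAt ?_
  unfold weightedSinhRatio
  refine (differentiableAt_const _).mul (((hd z).div ?_ hden).div (by fun_prop) hsinh)
  exact (hd _).comp z (by fun_prop)

theorem norm_weightedSinhRatio_le {ζ : ℝ} (h0 : 0 < ζ) (h1 : ζ < Real.pi / 2) {w : ℂ}
    (hw : 1 ≤ |w.re|) : ‖weightedSinhRatio ζ w‖ ≤ 1 / (2 * ζ) / w.re ^ 2 := by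
  have hw0 : w ≠ 0 := by
    rintro rfl
    simp at hw
    linarith
  have hr : 2 ≤ Real.pi / ζ := by rw [le_div_iff₀ h0]; linarith
  have hx2 : 0 < w.re ^ 2 := by rw [← sq_abs]; positivity
  have hnum := norm_sinh_le_abs_sinh_re_add_one w
  have hs : 1 ≤ |Real.sinh w.re| := by
    rw [Real.abs_sinh]
    exact hw.trans (Real.self_le_sinh_iff.2 (abs_nonneg _))
  have hshift : |Real.sinh w.re| ≤ ‖Complex.sinh (w + ζ * Complex.I)‖ := by
    simpa using abs_sinh_re_le_norm_sinh (w + ζ * Complex.I)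
  have hscale : 2 * w.re ^ 2 ≤ ‖Complex.sinh ((Real.pi / ζ : ℝ) * w)‖ := by
    refine (two_mul_sq_le_abs_sinh_mul hr).trans ?_
    rw [← Complex.re_ofReal_mul]
    exact abs_sinh_re_le_norm_sinh _
  have hconst : ‖Complex.I / (2 * ζ)‖ = 1 / (2 * ζ) := by
    simp [abs_of_pos h0]
  rw [weightedSinhRatio_of_ne_zero h0.ne' hw0, norm_mul, hconst, norm_div, norm_div,
    div_eq_mul_one_div (1 / (2 * ζ)) (w.re ^ 2), div_div]
  refine mul_le_mul_of_nonneg_left ?_ (by positivity)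
  set A := ‖Complex.sinh ((Real.pi / ζ : ℝ) * w)‖
  set B := ‖Complex.sinh (w + ζ * Complex.I)‖
  have hB : 0 < B := by linarith
  rw [div_le_div_iff₀ (mul_pos (by linarith) hB) hx2]
  nlinarith [mul_le_mul_of_nonneg_right hscale hB.le,
    mul_le_mul_of_nonneg_right (by linarith : ‖Complex.sinh w‖ ≤ 2 * B) hx2.le]

theorem weightedSinhRatio_upper {ζ : ℝ} (h0 : 0 < ζ) (x : ℝ) :
    weightedSinhRatio ζ (x + (ζ / 2 : ℝ) * Complex.I) = (rho ζ x : ℂ) *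
      (Complex.sinh ((x : ℂ) + Complex.I * ζ / 2) /
        Complex.sinh ((x : ℂ) + 3 * Complex.I * ζ / 2)) := by
  have hζ : (ζ : ℂ) ≠ 0 := by exact_mod_cast h0.ne'
  have hw : (x : ℂ) + (ζ / 2 : ℝ) * Complex.I ≠ 0 := fun h => by
    have := congrArg Complex.im h
    simp at this
    exact h0.ne' this
  have hden : Complex.sinh ((Real.pi / ζ : ℝ) * (x + (ζ / 2 : ℝ) * Complex.I)) =
      Complex.cosh (Real.pi * x / ζ) * Complex.I := by
    rw [show ((Real.pi / ζ : ℝ) : ℂ) * (x + (ζ / 2 : ℝ) * Complex.I) =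
      Real.pi * x / ζ + Real.pi / 2 * Complex.I by push_cast; field_simp]
    simp [Complex.sinh_add, Complex.sinh_mul_I, Complex.cosh_mul_I]
  rw [weightedSinhRatio_of_ne_zero h0.ne' hw, hden, rho]
  rw [show (x : ℂ) + (ζ / 2 : ℝ) * Complex.I + ζ * Complex.I = x + 3 * Complex.I * ζ / 2 by
      push_cast; ring,
    show (x : ℂ) + (ζ / 2 : ℝ) * Complex.I = x + Complex.I * ζ / 2 by push_cast; ring]
  push_cast
  field_simp [Complex.I_ne_zero]

theorem weightedSinhRatio_lower {ζ : ℝ} (h0 : 0 < ζ) (x : ℝ) :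
    weightedSinhRatio ζ (x + (-(ζ / 2) : ℝ) * Complex.I) = -((rho ζ x : ℂ) *
      (Complex.sinh ((x : ℂ) - Complex.I * ζ / 2) /
        Complex.sinh ((x : ℂ) + Complex.I * ζ / 2))) := by
  have hζ : (ζ : ℂ) ≠ 0 := by exact_mod_cast h0.ne'
  have hw : (x : ℂ) + (-(ζ / 2) : ℝ) * Complex.I ≠ 0 := fun h => by
    have := congrArg Complex.im h
    simp at this
    exact h0.ne' this
  have hden : Complex.sinh ((Real.pi / ζ : ℝ) * (x + (-(ζ / 2) : ℝ) * Complex.I)) =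
      -(Complex.cosh (Real.pi * x / ζ) * Complex.I) := by
    rw [show ((Real.pi / ζ : ℝ) : ℂ) * (x + (-(ζ / 2) : ℝ) * Complex.I) =
      Real.pi * x / ζ - Real.pi / 2 * Complex.I by push_cast; field_simp; ring]
    simp [Complex.sinh_sub, Complex.sinh_mul_I, Complex.cosh_mul_I]
  rw [weightedSinhRatio_of_ne_zero h0.ne' hw, hden, rho]
  rw [show (x : ℂ) + (-(ζ / 2) : ℝ) * Complex.I + ζ * Complex.I = x + Complex.I * ζ / 2 by
      push_cast; ring,
    show (x : ℂ) + (-(ζ / 2) : ℝ) * Complex.I = x - Complex.I * ζ / 2 by push_cast; ring]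
  push_cast
  field_simp [Complex.I_ne_zero]

/-- Contour-shift identity for the density-weighted sinh ratios (K₂ = I₁):
∫ ρ(x) sinh(x+iζ/2)/sinh(x+3iζ/2) dx = −∫ ρ(x) sinh(x−iζ/2)/sinh(x+iζ/2) dx. -/
theorem stmt19 (ζ : ℝ) (h0 : 0 < ζ) (h1 : ζ < Real.pi / 2) :
    ∫ x : ℝ, (rho ζ x : ℂ) *
        (Complex.sinh ((x : ℂ) + Complex.I * ζ / 2) /
          Complex.sinh ((x : ℂ) + 3 * Complex.I * ζ / 2))
    = -∫ x : ℝ, (rho ζ x : ℂ) *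
        (Complex.sinh ((x : ℂ) - Complex.I * ζ / 2) /
          Complex.sinh ((x : ℂ) + Complex.I * ζ / 2)) := by
  rw [← integral_neg]
  simp only [← weightedSinhRatio_upper h0, ← weightedSinhRatio_lower h0]
  exact integral_horizontal_line_eq (differentiableOn_weightedSinhRatio h0 h1)
    fun z _ hz => norm_weightedSinhRatio_le h0 h1 hz
end
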